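/- For the boundary driven Kawasaki process on 𝒢_N with κ > 0, μ_L > 0 and μ_R > 0: the fully occupied configuration (1,1,…,1) is the unique dominant state, i.e. Ψ((1,…,1)) > Ψ(y) for every configuration y ≠ (1,…,1). -/

import Mathlib

open scoped Classical

namespace Kawasaki

/-- Configurations of the lattice gas on `{1,…,N}`: each site is occupied (`true`) or empty. -/
abbrev Config (N : ℕ) := Fin N → Bool

/-- Occupation number of site `i` as a real number. -/
noncomputable def occ {N : ℕ} (x : Config N) (i : Fin N) : ℝ := if x i then 1 else 0

/-- The nearest-neighbour interaction energy `E(x) = -κ ∑ x(i) x(i+1)`. -/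
noncomputable def energy {N : ℕ} (κ : ℝ) (x : Config N) : ℝ :=
  -κ * ∑ i : Fin N, ∑ j : Fin N, if (j : ℕ) = (i : ℕ) + 1 then occ x i * occ x j else 0

/-- `x^{i,j}`: the configuration with the occupations of `i` and `j` interchanged. -/
def swapConf {N : ℕ} (x : Config N) (i j : Fin N) : Config N :=
  Function.update (Function.update x i (x j)) j (x i)

/-- `x^i`: the configuration with the occupation at `i` flipped. -/
def flipConf {N : ℕ} (x : Config N) (i : Fin N) : Config N :=
  Function.update x i (!x i)

/-- The last site. -/
def lastIdx (N : ℕ) [NeZero N] : Fin N :=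
  ⟨N - 1, Nat.sub_lt (Nat.pos_of_ne_zero (NeZero.ne N)) Nat.one_pos⟩

/-- `y` is obtained from `x` by exchanging the occupations of two nearest neighbours. -/
def IsSwap {N : ℕ} (x y : Config N) : Prop :=
  ∃ i j : Fin N, (j : ℕ) = (i : ℕ) + 1 ∧ y = swapConf x i j

/-- The allowed transitions: nearest-neighbour exchanges in the bulk,
birth/death at the two boundary sites. -/
def Allowed {N : ℕ} [NeZero N] (x y : Config N) : Prop :=
  y ≠ x ∧ (IsSwap x y ∨ y = flipConf x 0 ∨ y = flipConf x (lastIdx N))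

/-- The transition rates of the boundary driven Kawasaki process at inverse temperature `β`. -/
noncomputable def rate {N : ℕ} [NeZero N] (κ μL μR β : ℝ) (x y : Config N) : ℝ :=
  if y = x then 0
  else if IsSwap x y then Real.exp (-(β / 2) * (energy κ y - energy κ x))
  else if y = flipConf x 0 then
    Real.exp (β * μL / 2 * (1 - 2 * occ x 0)) *
      Real.exp (-(β / 2) * (energy κ y - energy κ x))
  else if y = flipConf x (lastIdx N) then
    Real.exp (β * μR / 2 * (1 - 2 * occ x (lastIdx N))) *
      Real.exp (-(β / 2) * (energy κ y - energy κ x))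
  else 0

/-- `ρ` is a stationary probability distribution for the rates at inverse temperature `β`. -/
noncomputable def IsStationary {N : ℕ} [NeZero N] (κ μL μR β : ℝ) (ρ : Config N → ℝ) : Prop :=
  (∀ x, 0 ≤ ρ x) ∧ (∑ x, ρ x = 1) ∧
  ∀ x, ∑ y, ρ y * rate κ μL μR β y x = ρ x * ∑ y, rate κ μL μR β x y

/-- `φ(x,y) = lim_{β→∞} (1/β) log k(x→y;β)` (computed explicitly, the rates being
pure exponentials in `β`). -/
noncomputable def phi {N : ℕ} [NeZero N] (κ μL μR : ℝ) (x y : Config N) : ℝ :=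
  if IsSwap x y then -(energy κ y - energy κ x) / 2
  else if y = flipConf x 0 then
    μL * (1 - 2 * occ x 0) / 2 - (energy κ y - energy κ x) / 2
  else if y = flipConf x (lastIdx N) then
    μR * (1 - 2 * occ x (lastIdx N)) / 2 - (energy κ y - energy κ x) / 2
  else 0

/-- `Γ(x) = -max_y φ(x,y)` (maximum over the allowed transitions from `x`). -/
noncomputable def Gam {N : ℕ} [NeZero N] (κ μL μR : ℝ) (x : Config N) : ℝ :=
  - sSup (phi κ μL μR x '' {y | Allowed x y})

/-- `U(x,y) = -φ(x,y) - Γ(x)` (meaningful on allowed transitions). -/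
noncomputable def Ucost {N : ℕ} [NeZero N] (κ μL μR : ℝ) (x y : Config N) : ℝ :=
  - phi κ μL μR x y - Gam κ μL μR x

/-- The cost `U(D)` of a path: sum of `U` over consecutive steps. -/
noncomputable def pathCost {N : ℕ} [NeZero N] (κ μL μR : ℝ) : List (Config N) → ℝ
  | [] => 0
  | [_] => 0
  | a :: b :: l => Ucost κ μL μR a b + pathCost κ μL μR (b :: l)

/-- `𝒰(x,y)`: the minimal cost over all paths of allowed transitions from `x` to `y`. -/
noncomputable def Ucal {N : ℕ} [NeZero N] (κ μL μR : ℝ) (x y : Config N) : ℝ :=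
  sInf { c | ∃ L : List (Config N), L.Chain' Allowed ∧ L.head? = some x ∧
    L.getLast? = some y ∧ c = pathCost κ μL μR L }

/-- `t` encodes a spanning tree of the transition graph with all edges oriented toward `x`:
`t y` is the successor of `y` on the unique path from `y` to the root `x`. -/
def IsInTree {N : ℕ} [NeZero N] (t : Config N → Config N) (x : Config N) : Prop :=
  t x = x ∧ (∀ y, y ≠ x → Allowed y (t y)) ∧ ∀ y, ∃ n : ℕ, t^[n] y = x

/-- `U(𝒯_x)`: the sum of `U` over all (oriented) edges of the in-tree. -/
noncomputable def treeCost {N : ℕ} [NeZero N] (κ μL μR : ℝ) (t : Config N → Config N)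
    (x : Config N) : ℝ :=
  ∑ y : Config N, if y = x then 0 else Ucost κ μL μR y (t y)

/-- `Θ(x) = min_𝒯 U(𝒯_x)`. -/
noncomputable def Theta {N : ℕ} [NeZero N] (κ μL μR : ℝ) (x : Config N) : ℝ :=
  sInf { c | ∃ t, IsInTree t x ∧ c = treeCost κ μL μR t x }

/-- `Ψ = Γ - Θ`. -/
noncomputable def Psi {N : ℕ} [NeZero N] (κ μL μR : ℝ) (x : Config N) : ℝ :=
  Gam κ μL μR x - Theta κ μL μR x

/-- `η_{p,q}`: `p` occupied sites followed by `q = N - p` empty sites. -/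
def eta (N p : ℕ) : Config N := fun i => decide ((i : ℕ) < p)

/-- `x ∈ 𝒟` iff `x = η_{p,q}` with `p ≥ 3`, `q ≥ 2`, `p + q = N`. -/
def memD {N : ℕ} (x : Config N) : Prop :=
  ∃ p q : ℕ, 3 ≤ p ∧ 2 ≤ q ∧ p + q = N ∧ x = eta N p

/-- The configuration written in block form `(p_0,q_0,…,p_n,q_n)`:
`p_0` occupied sites, then `q_0` empty sites, and so on. -/
def blockConfig (ps qs : List ℕ) : List Bool :=
  (ps.zip qs).flatMap fun pq => List.replicate pq.1 true ++ List.replicate pq.2 false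

/-- `x ∈ 𝒫`: block form `(p_0,q_0,…,p_n,q_n)` with all `p_i ≥ 3`,
`q_i ≥ 3` for `i < n` and `q_n ≥ 2`. -/
def memP {N : ℕ} (x : Config N) : Prop :=
  ∃ ps qs : List ℕ, ps.length = qs.length ∧ 0 < ps.length ∧
    (∀ p ∈ ps, 3 ≤ p) ∧ (∀ q ∈ qs.dropLast, 3 ≤ q) ∧ (∀ q ∈ qs.getLast?, 2 ≤ q) ∧
    List.ofFn x = blockConfig ps qs

/-- `y` is obtained from `x` by one occupation switch of the form
`…11100… → …11010…` or `…00111… → …01011…`. -/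
def isSwitchE {N : ℕ} (x y : Config N) : Prop :=
  (∃ a : ℕ, ∃ h : a + 4 < N,
    x ⟨a, by omega⟩ = true ∧ x ⟨a + 1, by omega⟩ = true ∧ x ⟨a + 2, by omega⟩ = true ∧
    x ⟨a + 3, by omega⟩ = false ∧ x ⟨a + 4, by omega⟩ = false ∧
    y = swapConf x ⟨a + 2, by omega⟩ ⟨a + 3, by omega⟩) ∨
  (∃ a : ℕ, ∃ h : a + 4 < N,
    x ⟨a, by omega⟩ = false ∧ x ⟨a + 1, by omega⟩ = false ∧ x ⟨a + 2, by omega⟩ = true ∧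
    x ⟨a + 3, by omega⟩ = true ∧ x ⟨a + 4, by omega⟩ = true ∧
    y = swapConf x ⟨a + 1, by omega⟩ ⟨a + 2, by omega⟩)

/-- `y ∈ ℰ`: obtained from some `x ∈ 𝒫` by one such switch. -/
def memE {N : ℕ} (y : Config N) : Prop := ∃ x : Config N, memP x ∧ isSwitchE x y

/-- `y` is a preferred successor of `x`: an allowed transition with `U(x,y) = 0`. -/
def PreferredStep {N : ℕ} [NeZero N] (κ μL μR : ℝ) (x y : Config N) : Prop :=
  Allowed x y ∧ Ucost κ μL μR x y = 0

/-- `𝒜_x`: the set consisting of `x` together with all its preferred successors. -/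
def Attr {N : ℕ} [NeZero N] (κ μL μR : ℝ) (x : Config N) : Set (Config N) :=
  insert x {y | PreferredStep κ μL μR x y}

/-- A nonempty set `A` is an attractor when `𝒰 = 0` inside `A` and `𝒰 > 0` from `A`
to its complement. -/
def IsAttractor {N : ℕ} [NeZero N] (κ μL μR : ℝ) (A : Set (Config N)) : Prop :=
  A.Nonempty ∧ (∀ x ∈ A, ∀ y ∈ A, x ≠ y → Ucal κ μL μR x y = 0) ∧
  ∀ x ∈ A, ∀ y, y ∉ A → 0 < Ucal κ μL μR x y

end Kawasaki

namespace Kawasaki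

section Forest

variable {V : Type*} {A : V → V → Prop} {φ : V → V → ℝ} {G : V → ℝ}

/-- `t` encodes a spanning forest oriented toward the set of roots `R`. -/
structure IsForest (A : V → V → Prop) (t : V → V) (R : Set V) : Prop where
  fixed : ∀ u ∈ R, t u = u
  step : ∀ u, u ∉ R → A u (t u)
  reach : ∀ u, ∃ n : ℕ, t^[n] u ∈ R

/-- Total weight of the edges of the forest encoded by `t`. -/
noncomputable def forestWeight [Fintype V] (φ : V → V → ℝ) (t : V → V) : ℝ :=
  ∑ u, if t u = u then 0 else φ u (t u)

theorem IsForest.reroute {t t' : V → V} {R S R' : Set V} (h : IsForest A t R)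
    (hRS : R ⊆ S) (hoff : ∀ u, u ∉ S → t' u = t u)
    (hfix : ∀ u ∈ R', t' u = u) (hstep : ∀ u ∈ S, u ∉ R' → A u (t' u))
    (hreach : ∀ u ∈ S, ∃ n : ℕ, t'^[n] u ∈ R') : IsForest A t' R' where
  fixed := hfix
  step u hu := by
    by_cases hS : u ∈ S
    · exact hstep u hS hu
    · rw [hoff u hS]
      exact h.step u fun hR => hS (hRS hR)
  reach u := by
    obtain ⟨n, hn⟩ := h.reach u
    induction n generalizing u with
    | zero => exact hreach u (hRS hn)
    | succ n ih =>
      by_cases hS : u ∈ S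
      · exact hreach u hS
      · obtain ⟨m, hm⟩ := ih (t u) hn
        refine ⟨m + 1, ?_⟩
        rwa [Function.iterate_succ_apply, hoff u hS]

theorem exists_isForest_of_rank (r : V) (rank : V → ℕ)
    (h : ∀ y, y ≠ r → ∃ y', A y y' ∧ rank y' < rank y) : ∃ t, IsForest A t {r} := by
  choose! s hs using h
  refine ⟨fun u => if u = r then r else s u, by simp, ?_, ?_⟩
  · intro u hu
    have hu' : u ≠ r := hu
    simpa [hu'] using (hs u hu').1
  · intro u
    induction hk : rank u using Nat.strong_induction_on generalizing u with
    | _ k ih =>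
      by_cases hu : u = r
      · exact ⟨0, hu⟩
      · obtain ⟨n, hn⟩ := ih _ (hk ▸ (hs u hu).2) (s u) rfl
        refine ⟨n + 1, ?_⟩
        rw [Function.iterate_succ_apply]
        simpa [hu] using hn

variable [Fintype V]

theorem forestWeight_update (t : V → V) (a b : V) :
    forestWeight φ (Function.update t a b) = forestWeight φ t
      - (if t a = a then 0 else φ a (t a)) + (if b = a then 0 else φ a b) := by
  unfold forestWeight
  rw [← Finset.add_sum_erase _ _ (Finset.mem_univ a),
    ← Finset.add_sum_erase Finset.univ (fun u => if t u = u then 0 else φ u (t u))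
      (Finset.mem_univ a)]
  have : ∑ u ∈ Finset.univ.erase a, (if Function.update t a b u = u then 0
      else φ u (Function.update t a b u)) =
      ∑ u ∈ Finset.univ.erase a, (if t u = u then 0 else φ u (t u)) := by
    refine Finset.sum_congr rfl fun u hu => ?_
    rw [Function.update_of_ne (Finset.ne_of_mem_erase hu)]
  rw [this, Function.update_self]
  ring

/-- Moving one of the two roots `r`, `z` of a forest along the edge `r → b`. -/
theorem IsForest.move_root (hirr : ∀ x, ¬ A x x) (hG : ∀ x y, A x y → φ x y ≤ -G x)
    {t : V → V} {r z b : V} (h : IsForest A t {r, z}) (hrz : r ≠ z) (hrb : A r b) :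
    ∃ t', IsForest A t' {b, z} ∧
      forestWeight φ t + φ r b + (if b = z then 0 else G b) ≤ forestWeight φ t' := by
  have hne : b ≠ r := fun e => hirr r (e ▸ hrb)
  refine ⟨Function.update (Function.update t b b) r b, ?_, ?_⟩
  · refine h.reroute (S := {r, z, b}) (by intro; simp; tauto) ?_ ?_ ?_ ?_
    · intro u hu
      simp only [Set.mem_insert_iff, Set.mem_singleton_iff, not_or] at hu
      rw [Function.update_of_ne hu.1, Function.update_of_ne hu.2.2]
    · rintro u (rfl | rfl)
      · rw [Function.update_of_ne hne, Function.update_self]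
      · rw [Function.update_of_ne hrz.symm]
        by_cases hub : u = b
        · rw [hub, Function.update_self]
        · rw [Function.update_of_ne hub, h.fixed u (by simp)]
    · rintro u (rfl | rfl | rfl) hu
      · simpa using hrb
      · simp at hu
      · simp at hu
    · rintro u (rfl | rfl | rfl)
      · exact ⟨1, by simp⟩
      · exact ⟨0, by simp⟩
      · exact ⟨0, by simp⟩
  · rw [forestWeight_update, forestWeight_update, if_neg hne, Function.update_of_ne hne.symm,
      if_pos (h.fixed r (by simp)), if_pos rfl]
    by_cases hbz : b = z
    · rw [if_pos hbz, if_pos (h.fixed b (by simp [hbz]))]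
      linarith
    · have hA : A b (t b) := h.step b (by simp [hbz, hne])
      rw [if_neg hbz, if_neg fun e => hirr b (by rwa [e] at hA)]
      linarith [hG _ _ hA]

/-- Moving one of two roots to the other one along a path of maximal-weight steps. -/
theorem IsForest.merge_roots (hirr : ∀ x, ¬ A x x) (hG : ∀ x y, A x y → φ x y ≤ -G x)
    {r z : V} (hp : Relation.ReflTransGen (fun x y => A x y ∧ φ x y = -G x) r z)
    (hrz : r ≠ z) {t : V → V} (h : IsForest A t {r, z}) :
    ∃ t', IsForest A t' {z} ∧ forestWeight φ t - G r ≤ forestWeight φ t' := by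
  induction hp using Relation.ReflTransGen.head_induction_on generalizing t with
  | refl => exact absurd rfl hrz
  | @head r b hb _ ih =>
    obtain ⟨t₁, ht₁, hw⟩ := h.move_root hirr hG hrz hb.1
    by_cases hbz : b = z
    · subst hbz
      refine ⟨t₁, by simpa using ht₁, ?_⟩
      rw [if_pos rfl] at hw
      linarith [hb.2]
    · obtain ⟨t₂, ht₂, hw₂⟩ := ih hbz ht₁
      refine ⟨t₂, ht₂, ?_⟩
      rw [if_neg hbz] at hw
      linarith [hb.2]

/-- Changing the root of a spanning tree along an edge. -/
theorem IsForest.move_single_root (hirr : ∀ x, ¬ A x x)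
    {t : V → V} {r b : V} (h : IsForest A t {r}) (hrb : A r b) :
    ∃ t', IsForest A t' {b} ∧
      forestWeight φ t + φ r b - φ b (t b) ≤ forestWeight φ t' := by
  have hne : b ≠ r := fun e => hirr r (e ▸ hrb)
  refine ⟨Function.update (Function.update t b b) r b, ?_, ?_⟩
  · refine h.reroute (S := {r, b}) (by simp) ?_ ?_ ?_ ?_
    · intro u hu
      simp only [Set.mem_insert_iff, Set.mem_singleton_iff, not_or] at hu
      rw [Function.update_of_ne hu.1, Function.update_of_ne hu.2]
    · rintro u rfl
      rw [Function.update_of_ne hne, Function.update_self]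
    · rintro u (rfl | rfl) hu
      · simpa using hrb
      · simp at hu
    · rintro u (rfl | rfl)
      · exact ⟨1, by simp⟩
      · exact ⟨0, by simp⟩
  · have hA : A b (t b) := h.step b (by simp [hne])
    rw [forestWeight_update, forestWeight_update, if_neg hne, Function.update_of_ne hne.symm,
      if_pos (h.fixed r (by simp)), if_pos rfl, if_neg fun e => hirr b (by rwa [e] at hA)]
    linarith

theorem exists_isForest_of_reachable (hirr : ∀ x, ¬ A x x) {r z : V}
    (hp : Relation.ReflTransGen A r z) (h : ∃ t, IsForest A t {r}) :
    ∃ t, IsForest A t {z} := by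
  induction hp with
  | refl => exact h
  | tail _ hb ih =>
    obtain ⟨t, ht⟩ := ih
    obtain ⟨t', ht', -⟩ := ht.move_single_root (φ := fun _ _ => 0) hirr hb
    exact ⟨t', ht'⟩

/-- `z` is the bottom of a well of depth at least `B`. -/
def IsDeep (A : V → V → Prop) (φ : V → V → ℝ) (z : V) (B : ℝ) : Prop :=
  ∀ w, A z w → φ z w ≤ -B / 2 ∧ ∀ v, v ≠ z → A w v → φ w v ≤ 0

/-- Detaching a deep well from a spanning tree gains its depth. -/
theorem IsForest.detach (hirr : ∀ x, ¬ A x x) (hsymm : ∀ x y, A x y → A y x)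
    (hanti : ∀ x y, A x y → φ y x = -φ x y) {z : V} {B : ℝ} (hz : IsDeep A φ z B)
    {t : V → V} {y : V} (h : IsForest A t {y}) (hyz : y ≠ z) (hy : t z ≠ y) :
    ∃ t', IsForest A t' {y, z} ∧ forestWeight φ t + B ≤ forestWeight φ t' := by
  have hA : A z (t z) := h.step z (by simpa using hyz.symm)
  have hne : t z ≠ z := fun e => hirr z (by rwa [e] at hA)
  have hA' : A (t z) (t (t z)) := h.step (t z) (by simpa using hy)
  have hne' : t (t z) ≠ t z := fun e => hirr (t z) (by rwa [e] at hA')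
  have hcyc : t (t z) ≠ z := by
    intro e
    have key : ∀ n, t^[n] z = z ∨ t^[n] z = t z := by
      intro n
      induction n with
      | zero => exact Or.inl rfl
      | succ n ih =>
        rw [Function.iterate_succ_apply']
        rcases ih with ih | ih <;> rw [ih]
        · exact Or.inr rfl
        · exact Or.inl e
    obtain ⟨n, hn⟩ := h.reach z
    have hn' : t^[n] z = y := hn
    rcases key n with k | k
    · exact hyz (hn'.symm.trans k)
    · exact hy (k.symm.trans hn')
  refine ⟨Function.update (Function.update t z z) (t z) z, ?_, ?_⟩
  · refine h.reroute (S := {y, z, t z}) (by simp) ?_ ?_ ?_ ?_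
    · intro u hu
      simp only [Set.mem_insert_iff, Set.mem_singleton_iff, not_or] at hu
      rw [Function.update_of_ne hu.2.2, Function.update_of_ne hu.2.1]
    · rintro u (rfl | rfl)
      · rw [Function.update_of_ne hy.symm, Function.update_of_ne hyz, h.fixed u rfl]
      · rw [Function.update_of_ne hne.symm, Function.update_self]
    · rintro u (rfl | rfl | rfl) hu
      · simp at hu
      · simp at hu
      · rw [Function.update_self]
        exact hsymm _ _ hA
    · rintro u (rfl | rfl | rfl)
      · exact ⟨0, by simp⟩
      · exact ⟨0, by simp⟩
      · exact ⟨1, by simp⟩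
  · rw [forestWeight_update, forestWeight_update, Function.update_of_ne hne, if_neg hne',
      if_neg hne, if_neg hne.symm, if_pos rfl, hanti _ _ hA]
    have h1 := (hz _ hA).1
    have h2 := (hz _ hA).2 _ hcyc hA'
    linarith

end Forest

section Local

variable {N : ℕ}

/-- The occupation variables, with sites numbered from `1` and empty sites added outside. -/
def pad (x : Config N) : ℕ → Bool
  | 0 => false
  | k + 1 => if h : k < N then x ⟨k, h⟩ else false

/-- The integer `0` or `1` associated with an occupation variable. -/
def bz (b : Bool) : ℤ := cond b 1 0

@[simp] theorem bz_true : bz true = 1 := rfl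
@[simp] theorem bz_false : bz false = 0 := rfl

@[simp] theorem pad_zero (x : Config N) : pad x 0 = false := rfl

theorem pad_succ (x : Config N) {k : ℕ} (h : k < N) : pad x (k + 1) = x ⟨k, h⟩ := by
  simp [pad, h]

theorem pad_of_lt (x : Config N) {k : ℕ} (h : N < k) : pad x k = false := by
  obtain ⟨k, rfl⟩ : ∃ j, k = j + 1 := ⟨k - 1, by omega⟩
  simp [pad]; omega

theorem eq_of_pad {x y : Config N} (h : ∀ k, 1 ≤ k → k ≤ N → pad x k = pad y k) : x = y := by
  funext i
  have := h (i + 1) (by omega) (by omega)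
  rwa [pad_succ x i.2, pad_succ y i.2] at this

theorem pad_all_true {k : ℕ} (h1 : 1 ≤ k) (h2 : k ≤ N) :
    pad ((fun _ => true) : Config N) k = true := by
  obtain ⟨k, rfl⟩ : ∃ j, k = j + 1 := ⟨k - 1, by omega⟩
  rw [pad_succ _ (by omega)]

/-- Exchange of the sites `k + 1` and `k + 2` in the numbering of `pad`. -/
def sw (x : Config N) (k : ℕ) (h : k + 1 < N) : Config N :=
  swapConf x ⟨k, by omega⟩ ⟨k + 1, h⟩

theorem pad_sw (x : Config N) (k : ℕ) (h : k + 1 < N) (j : ℕ) :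
    pad (sw x k h) j =
      if j = k + 1 then pad x (k + 2) else if j = k + 2 then pad x (k + 1) else pad x j := by
  rcases j with _ | j
  · simp
  · by_cases hj : j < N
    · rw [pad_succ _ hj, pad_succ _ hj, pad_succ x (show k < N by omega), pad_succ x h]
      simp only [sw, swapConf, Function.update_apply, Fin.mk.injEq]
      split_ifs <;> first | rfl | omega
    · rw [pad_of_lt _ (by omega), if_neg (by omega), if_neg (by omega), pad_of_lt _ (by omega)]

theorem pad_flip (x : Config N) (i : Fin N) (j : ℕ) :
    pad (flipConf x i) j = if j = i + 1 then !pad x j else pad x j := by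
  rcases j with _ | j
  · simp
  · by_cases hj : j < N
    · rw [pad_succ _ hj, pad_succ _ hj]
      simp only [flipConf, Function.update_apply, Fin.ext_iff]
      by_cases e : j = i
      · subst e; simp
      · simp [e]
    · rw [pad_of_lt _ (by omega), if_neg (by omega), pad_of_lt _ (by omega)]

theorem sum_sub_sum_of_local (h : Bool → Bool → ℤ) {f g : ℕ → Bool} {k M : ℕ} (hk : k + 1 < M)
    (hfg : ∀ j, j ≠ k + 1 → j ≠ k + 2 → g j = f j) :
    ∑ j ∈ Finset.range (M + 1), h (g j) (g (j + 1)) =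
      ∑ j ∈ Finset.range (M + 1), h (f j) (f (j + 1))
      + (h (f k) (g (k + 1)) - h (f k) (f (k + 1)))
      + (h (g (k + 1)) (g (k + 2)) - h (f (k + 1)) (f (k + 2)))
      + (h (g (k + 2)) (f (k + 3)) - h (f (k + 2)) (f (k + 3))) := by
  have key : ∑ j ∈ ({k, k + 1, k + 2} : Finset ℕ),
        (h (g j) (g (j + 1)) - h (f j) (f (j + 1))) =
      ∑ j ∈ Finset.range (M + 1), (h (g j) (g (j + 1)) - h (f j) (f (j + 1))) := by
    refine Finset.sum_subset ?_ ?_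
    · intro j hj
      simp only [Finset.mem_insert, Finset.mem_singleton] at hj
      simp only [Finset.mem_range]
      omega
    · intro j _ hj
      simp only [Finset.mem_insert, Finset.mem_singleton, not_or] at hj
      rw [hfg j (by omega) (by omega), hfg (j + 1) (by omega) (by omega), sub_self]
  rw [Finset.sum_insert (by simp), Finset.sum_insert (by simp), Finset.sum_singleton,
    Finset.sum_sub_distrib, hfg k (by omega) (by omega),
    hfg (k + 2 + 1) (by omega) (by omega)] at key
  have e1 : k + 1 + 1 = k + 2 := rfl
  have e2 : k + 2 + 1 = k + 3 := rfl
  rw [e1, e2] at key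
  linarith

/-- The number of pairs of neighbouring occupied sites. -/
def bonds (x : Config N) : ℤ :=
  ∑ j ∈ Finset.range (N + 1), bz (pad x j) * bz (pad x (j + 1))

/-- The number of occupied sites plus the number of bonds. -/
def score (x : Config N) : ℤ :=
  ∑ j ∈ Finset.range (N + 1), (bz (pad x j) + bz (pad x j) * bz (pad x (j + 1)))

theorem energy_eq (κ : ℝ) (x : Config N) : energy κ x = -κ * bonds x := by
  unfold energy bonds
  congr 1
  rw [Finset.sum_range_succ', pad_zero, bz_false, zero_mul, add_zero, Int.cast_sum,
    Finset.sum_range fun j => ((bz (pad x (j + 1)) * bz (pad x (j + 1 + 1)) : ℤ) : ℝ)]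
  refine Finset.sum_congr rfl fun i _ => ?_
  have hocc : ∀ j : Fin N, occ x j = bz (pad x (j + 1)) := by
    intro j
    rw [pad_succ x j.2, occ]
    rcases x j <;> simp
  by_cases hi : (i : ℕ) + 1 < N
  · rw [Finset.sum_eq_single (⟨i + 1, hi⟩ : Fin N)]
    · simp [hocc]
    · intro j _ hj
      rw [if_neg fun e => hj (Fin.ext e)]
    · simp
  · rw [pad_of_lt x (show N < (i : ℕ) + 1 + 1 by omega), bz_false, mul_zero]
    rw [Finset.sum_eq_zero]
    · simp
    · intro j _
      rw [if_neg (by omega)]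

/-- Change of the number of bonds when exchanging two different neighbours. -/
theorem bonds_sw (x : Config N) (k : ℕ) (h : k + 1 < N) :
    bonds (sw x k h) = bonds x +
      (bz (pad x k) - bz (pad x (k + 3))) * (bz (pad x (k + 2)) - bz (pad x (k + 1))) := by
  unfold bonds
  rw [sum_sub_sum_of_local (fun a b => bz a * bz b) h
    (f := pad x) (g := pad (sw x k h)) (fun j h1 h2 => by rw [pad_sw, if_neg h1, if_neg h2])]
  simp only [pad_sw]
  simp
  ring

theorem score_sw (x : Config N) (k : ℕ) (h : k + 1 < N) :
    score (sw x k h) = score x +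
      (bz (pad x k) - bz (pad x (k + 3))) * (bz (pad x (k + 2)) - bz (pad x (k + 1))) := by
  unfold score
  rw [sum_sub_sum_of_local (fun a b => bz a + bz a * bz b) h
    (f := pad x) (g := pad (sw x k h)) (fun j h1 h2 => by rw [pad_sw, if_neg h1, if_neg h2])]
  simp only [pad_sw]
  simp
  ring

theorem bz_not (b : Bool) : bz (!b) = 1 - bz b := by cases b <;> rfl

theorem sw_ne {x : Config N} {k : ℕ} {h : k + 1 < N} (hne : pad x (k + 1) ≠ pad x (k + 2)) :
    sw x k h ≠ x := by
  intro e
  have := pad_sw x k h (k + 1)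
  rw [e, if_pos rfl] at this
  exact hne this

theorem flipConf_ne (x : Config N) (i : Fin N) : flipConf x i ≠ x := by
  intro e
  have := congrFun e i
  simp [flipConf] at this

theorem flipConf_flipConf (x : Config N) (i : Fin N) : flipConf (flipConf x i) i = x := by
  simp [flipConf]

theorem swapConf_swapConf (x : Config N) (i j : Fin N) : swapConf (swapConf x i j) i j = x := by
  funext k
  simp only [swapConf, Function.update_apply]
  split_ifs <;> simp_all

theorem isSwap_symm {x y : Config N} (h : IsSwap x y) : IsSwap y x := by
  obtain ⟨i, j, hij, rfl⟩ := h
  exact ⟨i, j, hij, (swapConf_swapConf x i j).symm⟩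

theorem isSwap_sw (x : Config N) (k : ℕ) (h : k + 1 < N) : IsSwap x (sw x k h) :=
  ⟨_, _, rfl, rfl⟩

theorem not_isSwap_flipConf (x : Config N) (a : Fin N) : ¬ IsSwap x (flipConf x a) := by
  rintro ⟨i, j, hij, e⟩
  have hij' : i ≠ j := by rintro rfl; omega
  have h1 := congrFun e i
  have h2 := congrFun e j
  have h3 := congrFun e a
  simp only [flipConf, swapConf, Function.update_apply] at h1 h2 h3
  grind

theorem occ_eq (x : Config N) (i : Fin N) : occ x i = bz (pad x (i + 1)) := by
  rw [pad_succ x i.2, occ]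
  rcases x i <;> simp

theorem occ_flipConf (x : Config N) (i : Fin N) : occ (flipConf x i) i = 1 - occ x i := by
  simp only [occ, flipConf, Function.update_self]
  rcases x i <;> simp

variable [NeZero N]

theorem pad_flip_zero (x : Config N) (j : ℕ) :
    pad (flipConf x 0) j = if j = 1 then !pad x j else pad x j := by
  rw [pad_flip]; simp

theorem pad_flip_last (x : Config N) (j : ℕ) :
    pad (flipConf x (lastIdx N)) j = if j = N then !pad x j else pad x j := by
  have : N ≠ 0 := NeZero.ne N
  rw [pad_flip]
  have e : (lastIdx N : ℕ) + 1 = N := by simp only [lastIdx]; omega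
  rw [e]

theorem bonds_flip_zero (hN : 2 ≤ N) (x : Config N) :
    bonds (flipConf x 0) = bonds x + bz (pad x 2) * (1 - 2 * bz (pad x 1)) := by
  unfold bonds
  rw [sum_sub_sum_of_local (fun a b => bz a * bz b) (k := 0) (by omega)
    (f := pad x) (g := pad (flipConf x 0)) (fun j h1 h2 => by rw [pad_flip_zero, if_neg h1])]
  simp only [pad_flip_zero]
  simp [bz_not]
  ring

theorem score_flip_zero (hN : 2 ≤ N) (x : Config N) :
    score (flipConf x 0) = score x + (1 + bz (pad x 2)) * (1 - 2 * bz (pad x 1)) := by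
  unfold score
  rw [sum_sub_sum_of_local (fun a b => bz a + bz a * bz b) (k := 0) (by omega)
    (f := pad x) (g := pad (flipConf x 0)) (fun j h1 h2 => by rw [pad_flip_zero, if_neg h1])]
  simp only [pad_flip_zero]
  simp [bz_not]
  ring

theorem bonds_flip_last (hN : 2 ≤ N) (x : Config N) :
    bonds (flipConf x (lastIdx N)) =
      bonds x + bz (pad x (N - 1)) * (1 - 2 * bz (pad x N)) := by
  unfold bonds
  have e1 : N - 2 + 1 = N - 1 := by omega
  have e2 : N - 2 + 2 = N := by omega
  have e3 : N - 2 + 3 = N + 1 := by omega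
  rw [sum_sub_sum_of_local (fun a b => bz a * bz b) (k := N - 2) (by omega)
    (f := pad x) (g := pad (flipConf x (lastIdx N)))
    (fun j h1 h2 => by rw [pad_flip_last, if_neg (by omega)])]
  simp only [pad_flip_last, e1, e2, e3]
  rw [if_neg (by omega), if_pos trivial, pad_of_lt x (show N < N + 1 by omega)]
  simp [bz_not]
  ring

theorem score_flip_last (hN : 2 ≤ N) (x : Config N) :
    score (flipConf x (lastIdx N)) =
      score x + (1 + bz (pad x (N - 1))) * (1 - 2 * bz (pad x N)) := by
  unfold score
  have e1 : N - 2 + 1 = N - 1 := by omega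
  have e2 : N - 2 + 2 = N := by omega
  have e3 : N - 2 + 3 = N + 1 := by omega
  rw [sum_sub_sum_of_local (fun a b => bz a + bz a * bz b) (k := N - 2) (by omega)
    (f := pad x) (g := pad (flipConf x (lastIdx N)))
    (fun j h1 h2 => by rw [pad_flip_last, if_neg (by omega)])]
  simp only [pad_flip_last, e1, e2, e3]
  rw [if_neg (by omega), if_pos trivial, pad_of_lt x (show N < N + 1 by omega)]
  simp [bz_not]
  ring

theorem flip_last_ne_flip_zero (hN : 2 ≤ N) (x : Config N) :
    flipConf x (lastIdx N) ≠ flipConf x 0 := by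
  intro e
  have := congrArg (fun z => pad z 1) e
  simp only [pad_flip_last, pad_flip_zero] at this
  rw [if_neg (by omega)] at this
  simp at this

theorem allowed_irrefl (x : Config N) : ¬ Allowed x x := fun h => h.1 rfl

theorem allowed_symm (x y : Config N) (h : Allowed x y) : Allowed y x := by
  refine ⟨h.1.symm, ?_⟩
  rcases h.2 with h | rfl | rfl
  · exact Or.inl (isSwap_symm h)
  · exact Or.inr (Or.inl (flipConf_flipConf x 0).symm)
  · exact Or.inr (Or.inr (flipConf_flipConf x _).symm)

theorem allowed_sw {x : Config N} {k : ℕ} (h : k + 1 < N) (hne : pad x (k + 1) ≠ pad x (k + 2)) :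
    Allowed x (sw x k h) := ⟨sw_ne hne, Or.inl (isSwap_sw x k h)⟩

theorem allowed_flip_zero (x : Config N) : Allowed x (flipConf x 0) :=
  ⟨flipConf_ne x 0, Or.inr (Or.inl rfl)⟩

theorem allowed_flip_last (x : Config N) : Allowed x (flipConf x (lastIdx N)) :=
  ⟨flipConf_ne x _, Or.inr (Or.inr rfl)⟩

theorem Allowed.cases {x y : Config N} (h : Allowed x y) :
    (∃ k, ∃ hk : k + 1 < N, pad x (k + 1) ≠ pad x (k + 2) ∧ y = sw x k hk) ∨
      y = flipConf x 0 ∨ y = flipConf x (lastIdx N) := by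
  rcases h.2 with ⟨i, j, hij, rfl⟩ | h' | h'
  · have hk : (i : ℕ) + 1 < N := hij ▸ j.2
    have e : swapConf x i j = sw x i hk := by
      unfold sw
      congr 1
      exact Fin.ext hij
    refine Or.inl ⟨i, hk, fun hp => h.1 ?_, e⟩
    rw [e]
    refine eq_of_pad fun k _ _ => ?_
    rw [pad_sw]
    split_ifs with h1 h2
    · rw [h1, hp]
    · rw [h2, hp]
    · rfl
  · exact Or.inr (Or.inl h')
  · exact Or.inr (Or.inr h')

variable {κ μL μR : ℝ}

theorem phi_sw (x : Config N) (k : ℕ) (h : k + 1 < N) :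
    phi κ μL μR x (sw x k h) = κ / 2 * (((bz (pad x k) - bz (pad x (k + 3))) *
      (bz (pad x (k + 2)) - bz (pad x (k + 1))) : ℤ) : ℝ) := by
  rw [phi, if_pos (isSwap_sw x k h), energy_eq, energy_eq, bonds_sw]
  push_cast
  ring

theorem phi_flip_zero (hN : 2 ≤ N) (x : Config N) :
    phi κ μL μR x (flipConf x 0) =
      (μL + κ * bz (pad x 2)) / 2 * (1 - 2 * bz (pad x 1)) := by
  rw [phi, if_neg (not_isSwap_flipConf x 0), if_pos rfl, energy_eq, energy_eq,
    bonds_flip_zero hN, occ_eq]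
  push_cast
  simp only [Fin.coe_ofNat_eq_mod, Nat.zero_mod, zero_add]
  ring

theorem phi_flip_last (hN : 2 ≤ N) (x : Config N) :
    phi κ μL μR x (flipConf x (lastIdx N)) =
      (μR + κ * bz (pad x (N - 1))) / 2 * (1 - 2 * bz (pad x N)) := by
  have e : (lastIdx N : ℕ) + 1 = N := by simp only [lastIdx]; omega
  rw [phi, if_neg (not_isSwap_flipConf x _), if_neg (flip_last_ne_flip_zero hN x), if_pos rfl,
    energy_eq, energy_eq, bonds_flip_last hN, occ_eq, e]
  push_cast
  ring

theorem phi_anti (hN : 2 ≤ N) (x y : Config N) (h : Allowed x y) :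
    phi κ μL μR y x = -phi κ μL μR x y := by
  rcases h.2 with h | rfl | rfl
  · rw [phi, phi, if_pos h, if_pos (isSwap_symm h)]
    ring
  · have h1 := not_isSwap_flipConf x 0
    rw [phi, phi, if_neg h1, if_neg fun h => h1 (isSwap_symm h), if_pos rfl,
      if_pos (flipConf_flipConf x 0).symm, occ_flipConf]
    ring
  · have h1 := not_isSwap_flipConf x (lastIdx N)
    have h2 := flip_last_ne_flip_zero hN x
    have h3 : x ≠ flipConf (flipConf x (lastIdx N)) 0 := by
      intro e
      apply h2
      rw [← flipConf_flipConf (flipConf x (lastIdx N)) 0, ← e]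
    rw [phi, phi, if_neg h1, if_neg fun h => h1 (isSwap_symm h), if_neg h2, if_neg h3, if_pos rfl,
      if_pos (flipConf_flipConf x _).symm, occ_flipConf]
    ring

theorem phi_le_neg_Gam (x y : Config N) (h : Allowed x y) :
    phi κ μL μR x y ≤ -Gam κ μL μR x := by
  rw [Gam, neg_neg]
  exact le_csSup (Set.toFinite _).bddAbove ⟨y, h, rfl⟩

theorem exists_phi_eq_neg_Gam (x : Config N) :
    ∃ y, Allowed x y ∧ phi κ μL μR x y = -Gam κ μL μR x := by
  have hne : (phi κ μL μR x '' {y | Allowed x y}).Nonempty :=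
    ⟨_, _, allowed_flip_zero x, rfl⟩
  obtain ⟨y, hy, e⟩ := hne.csSup_mem (Set.toFinite _)
  exact ⟨y, hy, by rw [Gam, neg_neg, e]⟩

end Local

section Moves

variable {N : ℕ}

theorem sw_sw (x : Config N) (k : ℕ) (h : k + 1 < N) : sw (sw x k h) k h = x :=
  swapConf_swapConf x _ _

/-- The change in the number of bonds when two neighbours with occupations `b`, `c` are exchanged,
the adjacent sites having occupations `a` and `d`. -/
theorem swap_gain_eq (a b c d : Bool) : b ≠ c →
    (bz a - bz d) * (bz c - bz b) =
      if a = c ∧ d = b then 1 else if a = b ∧ d = c then -1 else 0 := by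
  revert a b c d; decide

variable [NeZero N] {κ μL μR : ℝ} {x y : Config N} {k : ℕ}

theorem phi_sw_of_alternating (h : k + 1 < N) (h0 : pad x k ≠ pad x (k + 1))
    (h1 : pad x (k + 1) ≠ pad x (k + 2)) (h2 : pad x (k + 2) ≠ pad x (k + 3)) :
    phi κ μL μR x (sw x k h) = κ / 2 ∧ score (sw x k h) = score x + 1 := by
  have key : ∀ a b c d : Bool, a ≠ b → b ≠ c → c ≠ d → a = c ∧ d = b := by decide
  rw [phi_sw, score_sw, swap_gain_eq _ _ _ _ h1, if_pos (key _ _ _ _ h0 h1 h2)]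
  simp

theorem phi_sw_of_flat (h : k + 1 < N) (h0 : pad x k = pad x (k + 3))
    (h1 : pad x (k + 1) ≠ pad x (k + 2)) :
    phi κ μL μR x (sw x k h) = 0 ∧ score (sw x k h) = score x := by
  rw [phi_sw, score_sw, swap_gain_eq _ _ _ _ h1, if_neg (by grind), if_neg (by grind)]
  simp

theorem phi_sw_of_blocks (h : k + 1 < N) (h0 : pad x k = pad x (k + 1))
    (h1 : pad x (k + 1) ≠ pad x (k + 2)) (h2 : pad x (k + 2) = pad x (k + 3)) :
    phi κ μL μR x (sw x k h) = -κ / 2 ∧ score (sw x k h) = score x - 1 := by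
  rw [phi_sw, score_sw, swap_gain_eq _ _ _ _ h1, if_neg (by grind), if_pos (by grind)]
  constructor
  · push_cast; ring
  · ring

theorem phi_sw_le (hκ : 0 < κ) (h : k + 1 < N) (h1 : pad x (k + 1) ≠ pad x (k + 2)) :
    phi κ μL μR x (sw x k h) ≤ κ / 2 := by
  rw [phi_sw, swap_gain_eq _ _ _ _ h1]
  split_ifs <;> push_cast <;> linarith

theorem phi_sw_le_zero (hκ : 0 < κ) (h : k + 1 < N) (h1 : pad x (k + 1) ≠ pad x (k + 2))
    (h2 : pad x k = pad x (k + 1) ∨ pad x (k + 2) = pad x (k + 3)) :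
    phi κ μL μR x (sw x k h) ≤ 0 := by
  rw [phi_sw, swap_gain_eq _ _ _ _ h1, if_neg (by grind)]
  split_ifs <;> push_cast <;> linarith

theorem bz_nonneg (b : Bool) : (0 : ℝ) ≤ bz b := by cases b <;> simp

theorem phi_flip_zero_of_empty (hN : 2 ≤ N) (hκ : 0 < κ) (hμL : 0 < μL)
    (h : pad x 1 = false) : 0 < phi κ μL μR x (flipConf x 0) := by
  rw [phi_flip_zero hN, h]
  have := mul_nonneg hκ.le (bz_nonneg (pad x 2))
  simp
  linarith

theorem phi_flip_last_of_empty (hN : 2 ≤ N) (hκ : 0 < κ) (hμR : 0 < μR)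
    (h : pad x N = false) : 0 < phi κ μL μR x (flipConf x (lastIdx N)) := by
  rw [phi_flip_last hN, h]
  have := mul_nonneg hκ.le (bz_nonneg (pad x (N - 1)))
  simp
  linarith

theorem phi_flip_zero_of_occupied (hN : 2 ≤ N) (h : pad x 1 = true) :
    phi κ μL μR x (flipConf x 0) = -(μL + κ * bz (pad x 2)) / 2 := by
  rw [phi_flip_zero hN, h]
  simp
  ring

theorem phi_flip_last_of_occupied (hN : 2 ≤ N) (h : pad x N = true) :
    phi κ μL μR x (flipConf x (lastIdx N)) = -(μR + κ * bz (pad x (N - 1))) / 2 := by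
  rw [phi_flip_last hN, h]
  simp
  ring

theorem phi_flip_zero_nonpos (hN : 2 ≤ N) (hκ : 0 < κ) (hμL : 0 < μL) (h : pad x 1 = true) :
    phi κ μL μR x (flipConf x 0) ≤ 0 := by
  rw [phi_flip_zero_of_occupied hN h]
  have := mul_nonneg hκ.le (bz_nonneg (pad x 2))
  linarith

theorem phi_flip_last_nonpos (hN : 2 ≤ N) (hκ : 0 < κ) (hμR : 0 < μR) (h : pad x N = true) :
    phi κ μL μR x (flipConf x (lastIdx N)) ≤ 0 := by
  rw [phi_flip_last_of_occupied hN h]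
  have := mul_nonneg hκ.le (bz_nonneg (pad x (N - 1)))
  linarith

theorem phi_le_of_ends (hN : 2 ≤ N) (hκ : 0 < κ) (hμL : 0 < μL) (hμR : 0 < μR)
    (h1 : pad x 1 = true) (h2 : pad x N = true) (h : Allowed x y) :
    phi κ μL μR x y ≤ κ / 2 := by
  rcases h.cases with ⟨k, hk, hne, rfl⟩ | rfl | rfl
  · exact phi_sw_le hκ hk hne
  · linarith [phi_flip_zero_nonpos (μR := μR) hN hκ hμL h1]
  · linarith [phi_flip_last_nonpos (μL := μL) hN hκ hμR h2]

theorem phi_le_zero_of_not_alternating (hN : 2 ≤ N) (hκ : 0 < κ) (hμL : 0 < μL) (hμR : 0 < μR)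
    (h1 : pad x 1 = true) (h2 : pad x N = true)
    (h3 : ∀ k, k + 1 < N → pad x k ≠ pad x (k + 1) → pad x (k + 1) ≠ pad x (k + 2) →
      pad x (k + 2) = pad x (k + 3)) (h : Allowed x y) :
    phi κ μL μR x y ≤ 0 := by
  rcases h.cases with ⟨k, hk, hne, rfl⟩ | rfl | rfl
  · refine phi_sw_le_zero hκ hk hne ?_
    by_cases e : pad x k = pad x (k + 1)
    · exact Or.inl e
    · exact Or.inr (h3 k hk e hne)
  · exact phi_flip_zero_nonpos hN hκ hμL h1
  · exact phi_flip_last_nonpos hN hκ hμR h2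

theorem score_lt_of_phi_pos (hN : 2 ≤ N) (hκ : 0 < κ) (hμL : 0 < μL) (hμR : 0 < μR)
    (h : Allowed x y) (hpos : 0 < phi κ μL μR x y) : score x < score y := by
  rcases h.cases with ⟨k, hk, hne, rfl⟩ | rfl | rfl
  · rw [phi_sw] at hpos
    rw [score_sw]
    have := pos_of_mul_pos_right hpos (by linarith)
    have := Int.cast_pos.mp this
    linarith
  · rw [score_flip_zero hN]
    cases h1 : pad x 1
    · cases pad x 2 <;> simp
    · linarith [phi_flip_zero_nonpos (μR := μR) hN hκ hμL h1]
  · rw [score_flip_last hN]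
    cases h1 : pad x N
    · cases pad x (N - 1) <;> simp
    · linarith [phi_flip_last_nonpos (μL := μL) hN hκ hμR h1]

theorem preferredStep_iff :
    PreferredStep κ μL μR x y ↔ Allowed x y ∧ phi κ μL μR x y = -Gam κ μL μR x := by
  unfold PreferredStep Ucost
  constructor <;> rintro ⟨h, e⟩ <;> exact ⟨h, by linarith⟩

theorem preferredStep_of_max (h : Allowed x y)
    (hmax : ∀ y', Allowed x y' → phi κ μL μR x y' ≤ phi κ μL μR x y) :
    PreferredStep κ μL μR x y := by
  obtain ⟨y', hy', e⟩ := exists_phi_eq_neg_Gam (κ := κ) (μL := μL) (μR := μR) x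
  exact preferredStep_iff.mpr ⟨h, le_antisymm (phi_le_neg_Gam x y h) (e ▸ hmax y' hy')⟩

end Moves

section Traps

variable {N : ℕ}

/-- Both boundary sites are occupied, and all maximal blocks have length at least `3`. -/
structure IsTrap (x : Config N) : Prop where
  first : pad x 1 = true
  last : pad x N = true
  run : ∀ j < N, pad x j ≠ pad x (j + 1) →
    pad x (j + 1) = pad x (j + 2) ∧ pad x (j + 2) = pad x (j + 3)

variable {x : Config N}

theorem IsTrap.occupied_left (hx : IsTrap x) (hN : 2 ≤ N) :
    pad x 2 = true ∧ pad x 3 = true := by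
  have h := hx.run 0 (by omega)
  have := hx.first
  have := pad_zero x
  grind

theorem IsTrap.run_left (hx : IsTrap x) (hN : 2 ≤ N) {j : ℕ} (hj : j ≤ N) (h1 : 1 ≤ j)
    (hne : pad x j ≠ pad x (j + 1)) :
    ∃ i, j = i + 3 ∧ pad x (i + 2) = pad x j ∧ pad x (i + 1) = pad x j := by
  have h0 := hx.occupied_left hN
  have hf := hx.first
  obtain ⟨i, rfl⟩ : ∃ i, j = i + 3 := by
    refine ⟨j - 3, ?_⟩
    have : j ≠ 1 := by rintro rfl; grind
    have : j ≠ 2 := by rintro rfl; grind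
    omega
  have ha := hx.run (i + 2) (by omega)
  have hb := hx.run (i + 1) (by omega)
  refine ⟨i, rfl, ?_, ?_⟩ <;> grind

theorem IsTrap.occupied_right (hx : IsTrap x) (hN : 2 ≤ N) :
    ∃ i, N = i + 3 ∧ pad x (i + 2) = true ∧ pad x (i + 1) = true := by
  have h := hx.run_left hN le_rfl (by omega)
  rw [pad_of_lt x (show N < N + 1 by omega), hx.last] at h
  exact h (by simp)

theorem IsTrap.swap_blocks (hx : IsTrap x) (hN : 2 ≤ N) {k : ℕ} (hk : k + 1 < N)
    (hne : pad x (k + 1) ≠ pad x (k + 2)) :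
    ∃ i, k = i + 2 ∧ pad x (i + 1) = pad x (i + 3) ∧ pad x (i + 2) = pad x (i + 3) ∧
      pad x (i + 4) = pad x (i + 5) ∧ pad x (i + 5) = pad x (i + 6) := by
  obtain ⟨i, hi, h1, h2⟩ := hx.run_left hN (by omega) (by omega) hne
  obtain rfl : k = i + 2 := by omega
  exact ⟨i, rfl, h2, h1, hx.run (i + 3) (by omega) hne⟩

variable [NeZero N] {κ μL μR : ℝ}

theorem isDeep_full (hN : 2 ≤ N) (hκ : 0 < κ) (hμL : 0 < μL) (hμR : 0 < μR) :
    IsDeep Allowed (phi κ μL μR) ((fun _ => true) : Config N) (κ + min μL μR) := by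
  set e : Config N := fun _ => true with he
  have hf : ∀ k, 1 ≤ k → k ≤ N → pad e k = true := fun k h1 h2 => pad_all_true h1 h2
  have hout := pad_of_lt e (show N < N + 1 by omega)
  have hmL := min_le_left μL μR
  have hmR := min_le_right μL μR
  intro w hw
  rcases hw.cases with ⟨k, hk, hne, rfl⟩ | rfl | rfl
  · exact absurd ((hf (k + 1) (by omega) (by omega)).trans (hf (k + 2) (by omega) (by omega)).symm)
      hne
  · refine ⟨?_, fun v hv hv' => ?_⟩
    · rw [phi_flip_zero_of_occupied hN (hf 1 le_rfl (by omega)), hf 2 (by omega) hN]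
      simp
      linarith
    · rcases hv'.cases with ⟨k, hk, hne, rfl⟩ | rfl | rfl
      · refine phi_sw_le_zero hκ hk hne ?_
        have := hf (k + 2)
        have := hf (k + 1)
        have := pad_zero e
        simp only [pad_flip_zero] at hne ⊢
        grind
      · exact absurd (flipConf_flipConf e 0) hv
      · refine phi_flip_last_nonpos hN hκ hμR ?_
        rw [pad_flip_zero, if_neg (by omega)]
        exact hf N (by omega) le_rfl
  · refine ⟨?_, fun v hv hv' => ?_⟩
    · rw [phi_flip_last_of_occupied hN (hf N (by omega) le_rfl), hf (N - 1) (by omega) (by omega)]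
      simp
      linarith
    · rcases hv'.cases with ⟨k, hk, hne, rfl⟩ | rfl | rfl
      · refine phi_sw_le_zero hκ hk hne ?_
        have := hf (k + 2)
        have := hf (k + 1)
        simp only [pad_flip_last] at hne ⊢
        grind
      · refine phi_flip_zero_nonpos hN hκ hμL ?_
        rw [pad_flip_last, if_neg (by omega)]
        exact hf 1 le_rfl (by omega)
      · exact absurd (flipConf_flipConf e _) hv

theorem IsTrap.isDeep (hx : IsTrap x) (hN : 2 ≤ N) (hκ : 0 < κ) (hμL : 0 < μL) (hμR : 0 < μR) :
    IsDeep Allowed (phi κ μL μR) x κ := by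
  have hl := hx.occupied_left hN
  obtain ⟨n, rfl, hr2, hr1⟩ := hx.occupied_right hN
  have hlast := hx.last
  have hfirst := hx.first
  have hout := pad_of_lt x (show n + 3 < n + 4 by omega)
  intro w hw
  rcases hw.cases with ⟨k, hk, hne, rfl⟩ | rfl | rfl
  · obtain ⟨i, rfl, h1, h2, h3, h4⟩ := hx.swap_blocks hN hk hne
    refine ⟨(phi_sw_of_blocks hk h2 hne h3).1.le, fun v hv hv' => ?_⟩
    rcases hv'.cases with ⟨j, hj, hne', rfl⟩ | rfl | rfl
    · have hij : j ≠ i + 2 := by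
        rintro rfl
        exact hv (sw_sw x _ hk)
      refine phi_sw_le_zero hκ hj hne' ?_
      have hrun := hx.run j (by omega)
      simp only [pad_sw] at hne' ⊢
      grind
    · refine phi_flip_zero_nonpos hN hκ hμL ?_
      rw [pad_sw, if_neg (by omega), if_neg (by omega), hfirst]
    · refine phi_flip_last_nonpos hN hκ hμR ?_
      rw [pad_sw, if_neg (by omega), if_neg (by grind), hlast]
  · refine ⟨?_, fun v hv hv' => ?_⟩
    · rw [phi_flip_zero_of_occupied hN hfirst, hl.1]
      simp
      linarith
    · rcases hv'.cases with ⟨j, hj, hne', rfl⟩ | rfl | rfl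
      · refine phi_sw_le_zero hκ hj hne' ?_
        have hrun := hx.run j (by omega)
        have := pad_zero x
        simp only [pad_flip_zero] at hne' ⊢
        grind
      · exact absurd (flipConf_flipConf x 0) hv
      · refine phi_flip_last_nonpos hN hκ hμR ?_
        rw [pad_flip_zero, if_neg (by omega), hlast]
  · refine ⟨?_, fun v hv hv' => ?_⟩
    · rw [phi_flip_last_of_occupied hN hlast]
      simp only [Nat.reduceSubDiff, hr2]
      simp
      linarith
    · rcases hv'.cases with ⟨j, hj, hne', rfl⟩ | rfl | rfl
      · refine phi_sw_le_zero hκ hj hne' ?_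
        have hrun := hx.run j (by omega)
        simp only [pad_flip_last] at hne' ⊢
        grind
      · refine phi_flip_zero_nonpos hN hκ hμL ?_
        rw [pad_flip_last, if_neg (by omega), hfirst]
      · exact absurd (flipConf_flipConf x _) hv

end Traps

section Top

theorem bool_eq_of_ne {a b c : Bool} (h : a ≠ b) (h' : b ≠ c) : a = c := by
  revert a b c; decide

variable {N : ℕ} [NeZero N] {κ μL μR : ℝ} {x y z w : Config N}

/-- No sequence of preferred steps from `z` raises the score. -/
def IsTop (κ μL μR : ℝ) (z : Config N) : Prop :=
  ∀ w, Relation.ReflTransGen (PreferredStep κ μL μR) z w → score w ≤ score z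

theorem IsTop.of_reachable (hz : IsTop κ μL μR z)
    (h : Relation.ReflTransGen (PreferredStep κ μL μR) z w) (hs : score w = score z) :
    IsTop κ μL μR w := fun v hv => hs ▸ hz v (h.trans hv)

theorem exists_isTop (κ μL μR : ℝ) (y : Config N) :
    ∃ z, Relation.ReflTransGen (PreferredStep κ μL μR) y z ∧ IsTop κ μL μR z ∧
      score y ≤ score z := by
  obtain ⟨z, hz, hmax⟩ := Set.exists_max_image
    {z | Relation.ReflTransGen (PreferredStep κ μL μR) y z} score (Set.toFinite _) ⟨y, .refl⟩
  exact ⟨z, hz, fun w hw => hmax w (Relation.ReflTransGen.trans hz hw), hmax y .refl⟩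

theorem exists_preferredStep_of_phi_pos (hN : 2 ≤ N) (hκ : 0 < κ) (hμL : 0 < μL) (hμR : 0 < μR)
    (h : Allowed x y) (hpos : 0 < phi κ μL μR x y) :
    ∃ w, PreferredStep κ μL μR x w ∧ score x < score w := by
  obtain ⟨w, hw, e⟩ := exists_phi_eq_neg_Gam (κ := κ) (μL := μL) (μR := μR) x
  exact ⟨w, preferredStep_iff.mpr ⟨hw, e⟩, score_lt_of_phi_pos hN hκ hμL hμR hw
    (hpos.trans_le (e ▸ phi_le_neg_Gam x y h))⟩

theorem IsTop.phi_nonpos (hz : IsTop κ μL μR z) (hN : 2 ≤ N) (hκ : 0 < κ) (hμL : 0 < μL)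
    (hμR : 0 < μR) (h : Allowed z y) : phi κ μL μR z y ≤ 0 := by
  by_contra! hpos
  obtain ⟨w, hw, hlt⟩ := exists_preferredStep_of_phi_pos hN hκ hμL hμR h hpos
  exact absurd (hz w (.single hw)) (not_le.mpr hlt)

theorem IsTop.first (hz : IsTop κ μL μR z) (hN : 2 ≤ N) (hκ : 0 < κ) (hμL : 0 < μL)
    (hμR : 0 < μR) : pad z 1 = true := by
  by_contra h
  exact absurd (hz.phi_nonpos hN hκ hμL hμR (allowed_flip_zero z))
    (not_le.mpr (phi_flip_zero_of_empty hN hκ hμL (by simpa using h)))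

theorem IsTop.last (hz : IsTop κ μL μR z) (hN : 2 ≤ N) (hκ : 0 < κ) (hμL : 0 < μL)
    (hμR : 0 < μR) : pad z N = true := by
  by_contra h
  exact absurd (hz.phi_nonpos hN hκ hμL hμR (allowed_flip_last z))
    (not_le.mpr (phi_flip_last_of_empty hN hκ hμR (by simpa using h)))

theorem IsTop.sw_flat (hz : IsTop κ μL μR z) (hN : 2 ≤ N) (hκ : 0 < κ) (hμL : 0 < μL)
    (hμR : 0 < μR) {k : ℕ} (hk : k + 1 < N) (h0 : pad z k = pad z (k + 3))
    (h1 : pad z (k + 1) ≠ pad z (k + 2)) : IsTop κ μL μR (sw z k hk) := by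
  have hflat := phi_sw_of_flat (κ := κ) (μL := μL) (μR := μR) hk h0 h1
  refine hz.of_reachable (.single (preferredStep_of_max (allowed_sw hk h1) fun y hy => ?_)) hflat.2
  rw [hflat.1]
  exact hz.phi_nonpos hN hκ hμL hμR hy

theorem IsTop.not_isolated (hN : 2 ≤ N) (hκ : 0 < κ) (hμL : 0 < μL) (hμR : 0 < μR) (j : ℕ)
    (hz : IsTop κ μL μR z) (hj : j < N) (hne : pad z j ≠ pad z (j + 1)) :
    pad z (j + 1) = pad z (j + 2) := by
  have hlast := hz.last hN hκ hμL hμR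
  induction j generalizing z with
  | zero =>
    have hfirst := hz.first hN hκ hμL hμR
    by_contra hne'
    have h2 : pad z 2 = false := by grind
    have hN' : N ≠ 2 := by rintro rfl; grind
    by_cases h3 : pad z 3 = true
    · have hsw := phi_sw_of_alternating (κ := κ) (μL := μL) (μR := μR) (x := z) (k := 0)
        (by omega) hne hne' (by grind)
      have := hz.phi_nonpos hN hκ hμL hμR (allowed_sw (k := 0) (by omega) hne')
      linarith [hsw.1]
    · have := (hz.sw_flat hN hκ hμL hμR (k := 0) (by omega) (by simpa using h3) hne').first
        hN hκ hμL hμR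
      rw [pad_sw] at this
      simp [h2] at this
  | succ j ih =>
    by_contra hne'
    have h0 : pad z j = pad z (j + 1) := by
      by_contra h
      exact hne (ih hz (by omega) h hlast)
    have hk : j + 1 < N := by omega
    have hsw := hz.sw_flat hN hκ hμL hμR hk (h0.trans (bool_eq_of_ne hne hne')) hne
    have := ih hsw (by omega) (by simp only [pad_sw]; grind) (hsw.last hN hκ hμL hμR)
    simp only [pad_sw] at this
    grind

theorem IsTop.blocks (hz : IsTop κ μL μR z) (hN : 2 ≤ N) (hκ : 0 < κ) (hμL : 0 < μL)
    (hμR : 0 < μR) {k : ℕ} (hk : k + 1 < N) (h : pad z (k + 1) ≠ pad z (k + 2)) :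
    pad z k = pad z (k + 1) ∧ pad z (k + 2) = pad z (k + 3) := by
  refine ⟨?_, hz.not_isolated hN hκ hμL hμR (k + 1) (by omega) h⟩
  by_contra h0
  exact h (hz.not_isolated hN hκ hμL hμR k (by omega) h0)

theorem IsTop.phi_le (hz : IsTop κ μL μR z) (hN : 2 ≤ N) (hκ : 0 < κ) (hμL : 0 < μL)
    (hμR : 0 < μR) (h : Allowed z y) : phi κ μL μR z y ≤ -κ / 2 := by
  have hfirst := hz.first hN hκ hμL hμR
  have hlast := hz.last hN hκ hμL hμR
  rcases h.cases with ⟨k, hk, hne, rfl⟩ | rfl | rfl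
  · obtain ⟨h1, h2⟩ := hz.blocks hN hκ hμL hμR hk hne
    exact (phi_sw_of_blocks hk h1 hne h2).1.le
  · have h2 := hz.not_isolated hN hκ hμL hμR 0 (by omega) (by simp [hfirst])
    rw [phi_flip_zero_of_occupied hN hfirst, ← h2, hfirst]
    simp
    linarith
  · have h2 : pad z (N - 1) = true := by
      have := hz.not_isolated hN hκ hμL hμR (N - 1) (by omega)
      rw [show N - 1 + 1 = N by omega, show N - 1 + 2 = N + 1 by omega,
        pad_of_lt z (show N < N + 1 by omega), hlast] at this
      simpa using this
    rw [phi_flip_last_of_occupied hN hlast, h2]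
    simp
    linarith

theorem IsTop.sw_sw (hz : IsTop κ μL μR z) (hN : 2 ≤ N) (hκ : 0 < κ) (hμL : 0 < μL)
    (hμR : 0 < μR) {k l : ℕ} (hk : k + 1 < N) (hl : l + 1 < N)
    (h : pad z (k + 1) ≠ pad z (k + 2)) (hfirst : pad (sw z k hk) 1 = true)
    (hlast : pad (sw z k hk) N = true) (h0 : pad (sw z k hk) l ≠ pad (sw z k hk) (l + 1))
    (h1 : pad (sw z k hk) (l + 1) ≠ pad (sw z k hk) (l + 2))
    (h2 : pad (sw z k hk) (l + 2) ≠ pad (sw z k hk) (l + 3)) :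
    IsTop κ μL μR (sw (sw z k hk) l hl) := by
  obtain ⟨h3, h4⟩ := hz.blocks hN hκ hμL hμR hk h
  obtain ⟨e1, s1⟩ := phi_sw_of_blocks (κ := κ) (μL := μL) (μR := μR) hk h3 h h4
  obtain ⟨e2, s2⟩ := phi_sw_of_alternating (κ := κ) (μL := μL) (μR := μR) hl h0 h1 h2
  refine hz.of_reachable (.tail (.single (preferredStep_of_max (allowed_sw hk h) fun y hy => ?_))
    (preferredStep_of_max (allowed_sw hl h1) fun y hy => ?_)) (by omega)
  · rw [e1]
    exact hz.phi_le hN hκ hμL hμR hy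
  · rw [e2]
    exact phi_le_of_ends hN hκ hμL hμR hfirst hlast hy

theorem IsTop.not_pair (hN : 2 ≤ N) (hκ : 0 < κ) (hμL : 0 < μL) (hμR : 0 < μR) (j : ℕ)
    (hz : IsTop κ μL μR z) (hj : j + 1 < N) (hne : pad z j ≠ pad z (j + 1))
    (hN3 : N ≠ 2) : pad z (j + 2) = pad z (j + 3) := by
  induction j generalizing z with
  | zero =>
    have hfirst := hz.first hN hκ hμL hμR
    have hlast := hz.last hN hκ hμL hμR
    have heq := hz.not_isolated hN hκ hμL hμR 0 (by omega) hne
    by_contra hne'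
    have hN4 : N ≠ 3 := by rintro rfl; grind
    have h34 := (hz.blocks hN hκ hμL hμR (k := 1) (by omega) hne').2
    have := (hz.sw_sw hN hκ hμL hμR (k := 1) (l := 0) (by omega) (by omega) hne'
      (by simp [pad_sw, hfirst])
      (by rw [pad_sw, if_neg (by omega), if_neg (by omega), hlast])
      (by simp only [pad_sw]; grind) (by simp only [pad_sw]; grind)
      (by simp only [pad_sw]; grind)).first hN hκ hμL hμR
    simp only [pad_sw] at this
    grind
  | succ j ih =>
    have hfirst := hz.first hN hκ hμL hμR
    have hlast := hz.last hN hκ hμL hμR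
    have heq := hz.not_isolated hN hκ hμL hμR (j + 1) (by omega) hne
    have h0 := (hz.blocks hN hκ hμL hμR (k := j) (by omega) hne).1
    have hj0 : j ≠ 0 := by
      rintro rfl
      simp [hfirst] at h0
    by_contra hne'
    have hsw := hz.sw_sw hN hκ hμL hμR (k := j) (l := j + 1) (by omega) (by omega) hne
      (by rw [pad_sw, if_neg (by omega), if_neg (by omega), hfirst])
      (by rw [pad_sw, if_neg (by omega), if_neg (by omega), hlast])
      (by simp only [pad_sw]; grind) (by simp only [pad_sw]; grind)
      (by simp only [pad_sw]; grind)
    have := ih hsw (by omega) (by simp only [pad_sw]; grind)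
    simp only [pad_sw] at this
    grind

theorem IsTop.eq_full_or_isTrap (hz : IsTop κ μL μR z) (hN : 2 ≤ N) (hκ : 0 < κ) (hμL : 0 < μL)
    (hμR : 0 < μR) : z = (fun _ => true) ∨ IsTrap z := by
  have hfirst := hz.first hN hκ hμL hμR
  have hlast := hz.last hN hκ hμL hμR
  by_cases hN2 : N = 2
  · subst hN2
    refine Or.inl (eq_of_pad fun k h1 h2 => ?_)
    rw [pad_all_true h1 h2]
    interval_cases k <;> assumption
  · refine Or.inr ⟨hfirst, hlast, fun j hj hne => ?_⟩
    have heq := hz.not_isolated hN hκ hμL hμR j hj hne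
    refine ⟨heq, hz.not_pair hN hκ hμL hμR j ?_ hne hN2⟩
    by_contra h
    obtain rfl : N = j + 1 := by omega
    rw [pad_of_lt z (show j + 1 < j + 2 by omega), hlast] at heq
    simp at heq

theorem IsTop.exists_isDeep (hz : IsTop κ μL μR z) (hN : 2 ≤ N) (hκ : 0 < κ) (hμL : 0 < μL)
    (hμR : 0 < μR) :
    ∃ B, IsDeep Allowed (phi κ μL μR) z B ∧ κ ≤ B ∧ (z = (fun _ => true) → κ < B) := by
  have hμ : 0 < min μL μR := lt_min hμL hμR
  by_cases h : z = fun _ => true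
  · subst h
    exact ⟨_, isDeep_full hN hκ hμL hμR, by linarith, fun _ => by linarith⟩
  · exact ⟨κ, ((hz.eq_full_or_isTrap hN hκ hμL hμR).resolve_left h).isDeep hN hκ hμL hμR,
      le_rfl, fun e => absurd e h⟩

end Top

section Climb

variable {N : ℕ} {x y z : Config N}

theorem exists_hole (hy : y ≠ fun _ => true) :
    ∃ p < N, (∀ i, 1 ≤ i → i ≤ p → pad y i = true) ∧ pad y (p + 1) = false := by
  have hex : ∃ p, p < N ∧ pad y (p + 1) = false := by
    by_contra! h
    refine hy (eq_of_pad fun k h1 h2 => ?_)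
    obtain ⟨k, rfl⟩ : ∃ j, k = j + 1 := ⟨k - 1, by omega⟩
    rw [pad_all_true h1 h2]
    simpa using h k h2
  refine ⟨Nat.find hex, (Nat.find_spec hex).1, fun i h1 h2 => ?_, (Nat.find_spec hex).2⟩
  obtain ⟨i, rfl⟩ : ∃ j, i = j + 1 := ⟨i - 1, by omega⟩
  have := Nat.find_min hex (show i < _ from h2)
  have hlt : i < N := by have := (Nat.find_spec hex).1; omega
  simpa [hlt] using this

variable [NeZero N] {κ μL μR : ℝ}

/-- A single hole in the first block moves to the left boundary, where it is filled. -/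
theorem exists_score_lt_of_hole (hN : 2 ≤ N) (hκ : 0 < κ) (hμL : 0 < μL) (hμR : 0 < μR)
    {h m : ℕ} (h2 : 2 ≤ h) (hm : h + 2 ≤ m) (hmN : m + 2 < N) (hole : pad x h = false)
    (hocc : ∀ i, 1 ≤ i → i ≤ m → i ≠ h → pad x i = true)
    (hm1 : pad x (m + 1) = false) (hm2 : pad x (m + 2) = false)
    (hrun : ∀ j, m + 2 ≤ j → j < N → pad x j ≠ pad x (j + 1) → pad x (j + 1) = pad x (j + 2))
    (hlast : pad x N = true) :
    ∃ z, Relation.ReflTransGen (PreferredStep κ μL μR) x z ∧ score x + 1 < score z := by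
  have hfirst : pad x 1 = true := hocc 1 (by omega) (by omega) (by omega)
  induction h, h2 using Nat.le_induction generalizing x with
  | base =>
    have ho3 := hocc 3 (by omega) (by omega) (by omega)
    have hne : pad x (0 + 1) ≠ pad x (0 + 2) := by simp [hfirst, hole]
    obtain ⟨e, s⟩ := phi_sw_of_alternating (κ := κ) (μL := μL) (μR := μR) (x := x) (k := 0)
      (by omega) (by simp [hfirst]) hne (by simp [hole, ho3])
    have hstep : PreferredStep κ μL μR x (sw x 0 (by omega)) := by
      refine preferredStep_of_max (allowed_sw _ hne) fun y hy => ?_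
      rw [e]
      exact phi_le_of_ends hN hκ hμL hμR hfirst hlast hy
    obtain ⟨w, hw, hlt⟩ := exists_preferredStep_of_phi_pos (κ := κ) (μL := μL) (μR := μR) hN hκ
      hμL hμR (allowed_flip_zero (sw x 0 (by omega)))
      (phi_flip_zero_of_empty hN hκ hμL (by simp [pad_sw, hole]))
    exact ⟨w, .tail (.single hstep) hw, s ▸ hlt⟩
  | succ h h2 ih =>
    obtain ⟨k, rfl⟩ : ∃ k, h = k + 1 := ⟨h - 1, by omega⟩
    have hk0 := hocc k (by omega) (by omega) (by omega)
    have hk1 := hocc (k + 1) (by omega) (by omega) (by omega)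
    have hk3 := hocc (k + 3) (by omega) (by omega) (by omega)
    have hne : pad x (k + 1) ≠ pad x (k + 2) := by rw [hk1, hole]; decide
    obtain ⟨e, s⟩ := phi_sw_of_flat (κ := κ) (μL := μL) (μR := μR) (x := x) (k := k)
      (by omega) (by rw [hk0, hk3]) hne
    have hstep : PreferredStep κ μL μR x (sw x k (by omega)) := by
      refine preferredStep_of_max (allowed_sw _ hne) fun y hy => ?_
      rw [e]
      refine phi_le_zero_of_not_alternating hN hκ hμL hμR hfirst hlast (fun j hj n1 n2 => ?_) hy
      have a0 := hocc j
      have a1 := hocc (j + 1)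
      have a2 := hocc (j + 2)
      have a3 := hocc (j + 3)
      have r1 := hrun j
      have r2 := hrun (j + 1)
      grind
    obtain ⟨w, hw, hlt⟩ := ih (x := sw x k (by omega)) (by omega)
      (by rw [pad_sw, if_pos rfl, hole])
      (fun i h1 h2 h3 => by
        have := hocc i h1 h2
        simp only [pad_sw]
        grind)
      (by rw [pad_sw, if_neg (by omega), if_neg (by omega), hm1])
      (by rw [pad_sw, if_neg (by omega), if_neg (by omega), hm2])
      (fun j h1 h2 h3 => by
        have := hrun j h1 h2
        simp only [pad_sw] at h3 ⊢
        grind)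
      (by rw [pad_sw, if_neg (by omega), if_neg (by omega), hlast])
      (by rw [pad_sw, if_neg (by omega), if_neg (by omega), hfirst])
    exact ⟨w, .head hstep hw, s ▸ hlt⟩

theorem IsTrap.exists_climb (hy : IsTrap y) (hfull : y ≠ fun _ => true) (hN : 2 ≤ N) (hκ : 0 < κ)
    (hμL : 0 < μL) (hμR : 0 < μR) :
    ∃ x₁ x₂ z, Allowed y x₁ ∧ phi κ μL μR y x₁ = -κ / 2 ∧ score x₁ < score y ∧
      -κ / 2 ≤ Gam κ μL μR x₁ ∧ Allowed x₁ x₂ ∧ phi κ μL μR x₁ x₂ = 0 ∧ score x₂ < score y ∧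
      Relation.ReflTransGen (PreferredStep κ μL μR) x₂ z ∧ IsTop κ μL μR z ∧
      score y < score z := by
  obtain ⟨p, hpN, hocc, hp1⟩ := exists_hole hfull
  have hl := hy.occupied_left hN
  have hfirst := hy.first
  have hlast := hy.last
  have hp : 3 ≤ p := by
    by_contra h
    interval_cases p <;> simp_all
  obtain ⟨k, rfl⟩ : ∃ k, p = k + 3 := ⟨p - 3, by omega⟩
  have o1 := hocc (k + 1) (by omega) (by omega)
  have o2 := hocc (k + 2) (by omega) (by omega)
  have o3 := hocc (k + 3) (by omega) (by omega)
  have hne : pad y (k + 3) ≠ pad y (k + 4) := by simp [o3, hp1]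
  obtain ⟨h45, h56⟩ := hy.run (k + 3) hpN hne
  have e5 : pad y (k + 5) = false := by rw [← hp1]; exact h45.symm
  have e6 : pad y (k + 6) = false := by rw [← e5]; exact h56.symm
  have hN4 : N ≠ k + 4 := by rintro rfl; simp_all
  have hN5 : N ≠ k + 5 := by rintro rfl; simp_all
  have hN6 : N ≠ k + 6 := by rintro rfl; simp_all
  have hk : k + 2 + 1 < N := by omega
  have hk' : k + 1 + 1 < N := by omega
  obtain ⟨f1, s1⟩ := phi_sw_of_blocks (κ := κ) (μL := μL) (μR := μR) (x := y) hk (by rw [o2, o3])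
    hne (by rw [hp1, e5])
  set x₁ := sw y (k + 2) hk with hx₁
  have hpad1 := pad_sw y (k + 2) hk
  rw [← hx₁] at hpad1
  have first1 : pad x₁ 1 = true := by
    rw [hpad1, if_neg (by omega), if_neg (by omega), hfirst]
  have last1 : pad x₁ N = true := by
    rw [hpad1, if_neg (by omega), if_neg (by omega), hlast]
  have hne' : pad x₁ (k + 1 + 1) ≠ pad x₁ (k + 1 + 2) := by
    simp [hpad1, o2, hp1]
  obtain ⟨f2, s2⟩ := phi_sw_of_flat (κ := κ) (μL := μL) (μR := μR) (x := x₁) hk'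
    (by simp [hpad1, o1, o3]) hne'
  have hpad2 := pad_sw x₁ (k + 1) hk'
  have hG : -κ / 2 ≤ Gam κ μL μR x₁ := by
    obtain ⟨w, hw, e⟩ := exists_phi_eq_neg_Gam (κ := κ) (μL := μL) (μR := μR) x₁
    linarith [phi_le_of_ends (y := w) hN hκ hμL hμR first1 last1 hw]
  obtain ⟨z', hz', hlt⟩ := exists_score_lt_of_hole (κ := κ) (μL := μL) (μR := μR)
    (x := sw x₁ (k + 1) hk') (h := k + 2) (m := k + 4) hN hκ hμL hμR (by omega) (by omega)
    (by omega) (by simp [hpad2, hpad1, hp1])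
    (fun i h1 h2 h3 => by
      have := hocc i h1
      simp only [hpad2, hpad1]
      grind)
    (by simp [hpad2, hpad1, e5]) (by simp [hpad2, hpad1, e6])
    (fun j h1 h2 h3 => by
      have := hy.run j h2
      simp only [hpad2, hpad1] at h3 ⊢
      grind)
    (by rw [hpad2, if_neg (by omega), if_neg (by omega), last1])
  obtain ⟨z, hz, htop, hs⟩ := exists_isTop κ μL μR z'
  exact ⟨x₁, _, z, allowed_sw hk hne, f1, by omega, hG, allowed_sw hk' hne', f2, by omega,
    hz'.trans hz, htop, by omega⟩

end Climb

section Trees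

variable {N : ℕ} {x y z : Config N}

/-- The sum of the positions of the empty sites. -/
def holeSum (x : Config N) : ℕ := ∑ j ∈ Finset.range (N + 1), if pad x j then 0 else j

theorem holeSum_lt {p : ℕ} (hp : p < N) (hoff : ∀ j, j ≠ p → j ≠ p + 1 → pad y j = pad x j)
    (hx : pad x (p + 1) = false) (hy : pad y (p + 1) = true) : holeSum y < holeSum x := by
  have h1 : p + 1 ∈ Finset.range (N + 1) := by simp; omega
  have h2 : p ∈ (Finset.range (N + 1)).erase (p + 1) := by simp; omega
  unfold holeSum
  rw [← Finset.add_sum_erase _ _ h1, ← Finset.add_sum_erase _ _ h2,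
    ← Finset.add_sum_erase _ _ h1, ← Finset.add_sum_erase _ _ h2, hx, hy,
    Finset.sum_congr rfl fun j hj => by
      simp only [Finset.mem_erase] at hj
      rw [hoff j hj.1 hj.2.1]]
  split_ifs <;> simp_all
  omega

variable [NeZero N] {κ μL μR : ℝ}

theorem exists_isForest (y : Config N) : ∃ t, IsForest Allowed t {y} := by
  have hdown : ∀ y : Config N, y ≠ (fun _ => true) → ∃ y',
      Allowed y y' ∧ holeSum y' < holeSum y := by
    intro y hy
    obtain ⟨p, hp, hocc, hole⟩ := exists_hole hy
    rcases p with _ | p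
    · refine ⟨_, allowed_flip_zero y, holeSum_lt hp (fun j _ h => ?_) hole ?_⟩
      · rw [pad_flip_zero, if_neg h]
      · simp [pad_flip_zero, hole]
    · have hp1 := hocc (p + 1) (by omega) le_rfl
      have hne : pad y (p + 1) ≠ pad y (p + 2) := by rw [hp1, hole]; decide
      refine ⟨_, allowed_sw hp hne, holeSum_lt hp (fun j h h' => ?_) hole ?_⟩
      · rw [pad_sw, if_neg h, if_neg h']
      · simp [pad_sw, hp1]
  have hroot := exists_isForest_of_rank _ holeSum hdown
  suffices Relation.ReflTransGen Allowed (fun _ => true) y from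
    exists_isForest_of_reachable allowed_irrefl this hroot
  induction hk : holeSum y using Nat.strong_induction_on generalizing y with
  | _ k ih =>
    by_cases hy : y = fun _ => true
    · rw [hy]
    · obtain ⟨y', hA, hlt⟩ := hdown y hy
      exact .tail (ih _ (hk ▸ hlt) y' rfl) (allowed_symm _ _ hA)

theorem isInTree_iff {t : Config N → Config N} :
    IsInTree t x ↔ IsForest Allowed t {x} := by
  constructor
  · rintro ⟨h1, h2, h3⟩
    exact ⟨by simpa using h1, by simpa using h2, by simpa using h3⟩
  · rintro ⟨h1, h2, h3⟩
    exact ⟨by simpa using h1, by simpa using h2, by simpa using h3⟩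

theorem treeCost_eq {t : Config N → Config N} (h : IsInTree t x) :
    treeCost κ μL μR t x =
      Gam κ μL μR x - ∑ u : Config N, Gam κ μL μR u - forestWeight (phi κ μL μR) t := by
  have hG : Gam κ μL μR x = ∑ u, if u = x then Gam κ μL μR u else 0 := by simp
  rw [hG, treeCost, forestWeight, ← Finset.sum_sub_distrib, ← Finset.sum_sub_distrib]
  refine Finset.sum_congr rfl fun u _ => ?_
  by_cases hu : u = x
  · simp [hu, h.1]
  · have : t u ≠ u := (h.2.1 u hu).1
    simp only [hu, this, if_false, Ucost]
    ring

theorem finite_treeCosts (κ μL μR : ℝ) (x : Config N) :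
    {c : ℝ | ∃ t : Config N → Config N, IsInTree t x ∧ c = treeCost κ μL μR t x}.Finite :=
  (Set.finite_range fun t => treeCost κ μL μR t x).subset fun _ ⟨t, _, e⟩ => ⟨t, e.symm⟩

theorem le_Psi {t : Config N → Config N} (h : IsForest Allowed t {x}) :
    ∑ u : Config N, Gam κ μL μR u + forestWeight (phi κ μL μR) t ≤ Psi κ μL μR x := by
  have h' := isInTree_iff.mpr h
  have := csInf_le (finite_treeCosts κ μL μR x).bddBelow ⟨t, h', rfl⟩
  rw [treeCost_eq h'] at this
  rw [Psi, Theta]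
  linarith

theorem exists_Psi_eq (κ μL μR : ℝ) (x : Config N) : ∃ t, IsForest Allowed t {x} ∧
    Psi κ μL μR x = ∑ u : Config N, Gam κ μL μR u + forestWeight (phi κ μL μR) t := by
  obtain ⟨t₀, ht₀⟩ := exists_isForest x
  have hne : {c | ∃ t, IsInTree t x ∧ c = treeCost κ μL μR t x}.Nonempty :=
    ⟨_, t₀, isInTree_iff.mpr ht₀, rfl⟩
  obtain ⟨t, ht, e⟩ := hne.csInf_mem (finite_treeCosts κ μL μR x)
  refine ⟨t, isInTree_iff.mp ht, ?_⟩
  rw [Psi, Theta, e, treeCost_eq ht]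
  ring

theorem IsDeep.exists_heavier_of_parent {B : ℝ} (hN : 2 ≤ N)
    (hz : IsDeep Allowed (phi κ μL μR) z B) {t : Config N → Config N}
    (ht : IsForest Allowed t {y}) (hyz : y ≠ z) (htz : t z = y) :
    ∃ t', IsForest Allowed t' {z} ∧
      forestWeight (phi κ μL μR) t + B ≤ forestWeight (phi κ μL μR) t' := by
  have hA : Allowed z y := htz ▸ ht.step z (by simpa using hyz.symm)
  obtain ⟨t', ht', hw⟩ := ht.move_single_root (φ := phi κ μL μR) allowed_irrefl
    (allowed_symm _ _ hA)
  refine ⟨t', ht', ?_⟩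
  rw [htz, phi_anti hN z y hA] at hw
  linarith [(hz y hA).1]

end Trees

section Dominance

variable {N : ℕ} [NeZero N] {κ μL μR : ℝ} {x y z : Config N}

theorem Gam_le (hN : 2 ≤ N) (hκ : 0 < κ) (hμL : 0 < μL) (hy : y ≠ fun _ => true) :
    Gam κ μL μR y ≤ κ / 2 := by
  suffices ∃ w, Allowed y w ∧ -κ / 2 ≤ phi κ μL μR y w by
    obtain ⟨w, hw, h⟩ := this
    linarith [phi_le_neg_Gam (κ := κ) (μL := μL) (μR := μR) y w hw]
  obtain ⟨p, hp, hocc, hole⟩ := exists_hole hy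
  rcases p with _ | p
  · exact ⟨_, allowed_flip_zero y, by
      linarith [phi_flip_zero_of_empty (κ := κ) (μR := μR) hN hκ hμL hole]⟩
  · have hne : pad y (p + 1) ≠ pad y (p + 2) := by
      rw [hocc (p + 1) (by omega) le_rfl, hole]
      decide
    refine ⟨_, allowed_sw hp hne, ?_⟩
    rw [phi_sw, swap_gain_eq _ _ _ _ hne]
    split_ifs <;> push_cast <;> linarith

theorem exists_heavier_of_reachable {B : ℝ} (hN : 2 ≤ N)
    (hz : IsDeep Allowed (phi κ μL μR) z B)
    (hyz : Relation.ReflTransGen (PreferredStep κ μL μR) y z) (hne : y ≠ z)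
    {t : Config N → Config N} (ht : IsForest Allowed t {y}) (htz : t z ≠ y) :
    ∃ t', IsForest Allowed t' {z} ∧
      forestWeight (phi κ μL μR) t + B - Gam κ μL μR y ≤ forestWeight (phi κ μL μR) t' := by
  obtain ⟨t₁, ht₁, h₁⟩ := ht.detach allowed_irrefl allowed_symm (phi_anti hN) hz hne htz
  obtain ⟨t₂, ht₂, h₂⟩ := ht₁.merge_roots allowed_irrefl phi_le_neg_Gam
    (Relation.ReflTransGen.mono (fun _ _ h => preferredStep_iff.mp h) _ _ hyz) hne
  exact ⟨t₂, ht₂, by linarith⟩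

theorem IsTrap.Psi_le (hy : IsTrap y) (hfull : y ≠ fun _ => true) (hN : 2 ≤ N) (hκ : 0 < κ)
    (hμL : 0 < μL) (hμR : 0 < μR) :
    ∃ z : Config N, score y < score z ∧ (z = (fun _ => true) ∨ IsTrap z) ∧
      Psi κ μL μR y ≤ Psi κ μL μR z ∧
      (z = (fun _ => true) → Psi κ μL μR y < Psi κ μL μR z) := by
  obtain ⟨x₁, x₂, z, hA₁, hφ₁, hs₁, hG₁, hA₂, hφ₂, hs₂, hreach, htop, hs⟩ :=
    hy.exists_climb hfull hN hκ hμL hμR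
  obtain ⟨B, hdeep, hB, hBfull⟩ := htop.exists_isDeep hN hκ hμL hμR
  obtain ⟨t, ht, hΨ⟩ := exists_Psi_eq κ μL μR y
  have hyz : y ≠ z := by rintro rfl; omega
  have h₁z : x₁ ≠ z := by rintro rfl; omega
  have h₂z : x₂ ≠ z := by rintro rfl; omega
  have hgain : Psi κ μL μR y + B - κ ≤ Psi κ μL μR z := by
    by_cases htz : t z = y
    · obtain ⟨t', ht', hw⟩ := hdeep.exists_heavier_of_parent hN ht hyz htz
      linarith [le_Psi (κ := κ) (μL := μL) (μR := μR) ht']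
    · obtain ⟨t₀, ht₀, h₀⟩ := ht.detach allowed_irrefl allowed_symm (phi_anti hN) hdeep hyz htz
      obtain ⟨t₁, ht₁, h₁⟩ := ht₀.move_root allowed_irrefl
        (phi_le_neg_Gam (κ := κ) (μL := μL) (μR := μR)) hyz hA₁
      obtain ⟨t₂, ht₂, h₂⟩ := ht₁.move_root allowed_irrefl
        (phi_le_neg_Gam (κ := κ) (μL := μL) (μR := μR)) h₁z hA₂
      obtain ⟨t₃, ht₃, h₃⟩ := ht₂.merge_roots allowed_irrefl
        (phi_le_neg_Gam (κ := κ) (μL := μL) (μR := μR))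
        (Relation.ReflTransGen.mono (fun _ _ h => preferredStep_iff.mp h) _ _ hreach) h₂z
      rw [if_neg h₁z] at h₁
      rw [if_neg h₂z] at h₂
      linarith [le_Psi (κ := κ) (μL := μL) (μR := μR) ht₃]
  exact ⟨z, hs, htop.eq_full_or_isTrap hN hκ hμL hμR, by linarith,
    fun h => by linarith [hBfull h]⟩

theorem IsTrap.Psi_lt_full (hy : IsTrap y) (hfull : y ≠ fun _ => true) (hN : 2 ≤ N)
    (hκ : 0 < κ) (hμL : 0 < μL) (hμR : 0 < μR) :
    Psi κ μL μR y < Psi κ μL μR ((fun _ => true) : Config N) := by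
  by_contra hcon
  obtain ⟨y, ⟨hy, hfull, hcon⟩, hmax⟩ := Set.exists_max_image
    {y : Config N | IsTrap y ∧ y ≠ (fun _ => true) ∧
      ¬ Psi κ μL μR y < Psi κ μL μR ((fun _ => true) : Config N)} score (Set.toFinite _)
    ⟨y, hy, hfull, hcon⟩
  obtain ⟨z, hs, hz, hle, hlt⟩ := hy.Psi_le hfull hN hκ hμL hμR
  by_cases hzf : z = fun _ => true
  · exact hcon (hzf ▸ hlt hzf)
  · exact absurd (hmax z ⟨hz.resolve_left hzf, hzf, fun h => hcon (hle.trans_lt h)⟩)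
      (not_le.mpr hs)

theorem Psi_lt_full (hN : 2 ≤ N) (hκ : 0 < κ) (hμL : 0 < μL) (hμR : 0 < μR)
    (hfull : y ≠ fun _ => true) :
    Psi κ μL μR y < Psi κ μL μR ((fun _ => true) : Config N) := by
  by_cases hy : IsTrap y
  · exact hy.Psi_lt_full hfull hN hκ hμL hμR
  obtain ⟨z, hreach, htop, -⟩ := exists_isTop κ μL μR y
  have hz := htop.eq_full_or_isTrap hN hκ hμL hμR
  have hyz : y ≠ z := by
    rintro rfl
    exact hz.elim hfull hy
  obtain ⟨B, hdeep, hB, -⟩ := htop.exists_isDeep hN hκ hμL hμR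
  obtain ⟨t, ht, hΨ⟩ := exists_Psi_eq κ μL μR y
  have hlt : Psi κ μL μR y < Psi κ μL μR z := by
    by_cases htz : t z = y
    · obtain ⟨t', ht', hw⟩ := hdeep.exists_heavier_of_parent hN ht hyz htz
      linarith [le_Psi (κ := κ) (μL := μL) (μR := μR) ht']
    · obtain ⟨t', ht', hw⟩ := exists_heavier_of_reachable hN hdeep hreach hyz ht htz
      linarith [le_Psi (κ := κ) (μL := μL) (μR := μR) ht', Gam_le (μR := μR) hN hκ hμL hfull]
  by_cases hzf : z = fun _ => true
  · exact hzf ▸ hlt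
  · exact hlt.trans ((hz.resolve_left hzf).Psi_lt_full hzf hN hκ hμL hμR)

end Dominance

end Kawasaki

open Kawasaki in
/-- for `κ > 0`, `μ_L > 0`, `μ_R > 0` (region I), the fully occupied
configuration is the unique dominant state: it strictly maximizes `Ψ`. -/
theorem statement17 (N : ℕ) [NeZero N] (hN : 2 ≤ N) (κ μL μR : ℝ)
    (hκ : 0 < κ) (hμL : 0 < μL) (hμR : 0 < μR) :
    ∀ y : Config N, y ≠ ((fun _ => true) : Config N) →
      Psi κ μL μR y < Psi κ μL μR ((fun _ => true) : Config N) :=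
  fun _ hy => Psi_lt_full hN hκ hμL hμR hy
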